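/- There exists a constant C > 0 such that for every integer n ≥ 9 one has Δ_{8,8}(n) ≤ C · n^{−19/10}; equivalently, every n-element subset of [0,1]^8 contains 9 points spanning an 8-dimensional simplex of volume at most C · n^{−19/10}. -/

import Mathlib

open scoped RealInnerProductSpace

/-- The Gram matrix of a collection of `k` vectors in `ℝ^d`. -/
noncomputable def gram {d k : ℕ} (v : Fin k → EuclideanSpace ℝ (Fin d)) :
    Matrix (Fin k) (Fin k) ℝ :=
  Matrix.of fun i j => ⟪v i, v j⟫

/-- `vol v` is the `k`-dimensional volume of the parallelepiped spanned by
`v 1, …, v k`, i.e. the square root of the determinant of their Gram matrix.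
For `k = 0` it equals `1`. -/
noncomputable def vol {d k : ℕ} (v : Fin k → EuclideanSpace ℝ (Fin d)) : ℝ :=
  Real.sqrt (gram v).det

/-- The `k`-dimensional volume of the simplex with vertices `p 0, …, p k`. -/
noncomputable def simplexVol {d k : ℕ} (p : Fin (k + 1) → EuclideanSpace ℝ (Fin d)) : ℝ :=
  (Nat.factorial k : ℝ)⁻¹ * vol (fun i : Fin k => p i.succ - p 0)

/-- The minimum, over all `(k+1)`-element subsets of `X`, of the `k`-dimensional
volume of the simplex they span. -/
noncomputable def minSimplexVol (d k : ℕ) (X : Finset (EuclideanSpace ℝ (Fin d))) : ℝ :=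
  sInf { v : ℝ | ∃ p : Fin (k + 1) → EuclideanSpace ℝ (Fin d),
    Function.Injective p ∧ (∀ i, p i ∈ X) ∧ v = simplexVol p }

/-- `Delta k d n` is the supremum, over all `n`-element subsets `X` of the unit cube
`[0,1]^d`, of the minimum `k`-dimensional simplex volume among `(k+1)`-element
subsets of `X`. -/
noncomputable def Delta (k d n : ℕ) : ℝ :=
  sSup { v : ℝ | ∃ X : Finset (EuclideanSpace ℝ (Fin d)), X.card = n ∧
    (∀ x ∈ X, ∀ i, x i ∈ Set.Icc (0 : ℝ) 1) ∧ v = minSimplexVol d k X }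

theorem Matrix.abs_det_le_factorial_mul_prod {n : ℕ} (M : Matrix (Fin n) (Fin n) ℝ) (r : Fin n → ℝ)
    (h : ∀ i j, |M i j| ≤ r i) : |M.det| ≤ n.factorial * ∏ i, r i := by
  rw [← Matrix.det_transpose, Matrix.det_apply]
  refine (Finset.abs_sum_le_sum_abs _ _).trans ?_
  have key : ∀ σ : Equiv.Perm (Fin n),
      |Equiv.Perm.sign σ • ∏ i, M.transpose (σ i) i| ≤ ∏ i, r i := by
    intro σ
    have h1 : |Equiv.Perm.sign σ • ∏ i, M.transpose (σ i) i| = ∏ i, |M i (σ i)| := by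
      rcases Int.units_eq_one_or (Equiv.Perm.sign σ) with hs | hs <;>
        simp [hs, Finset.abs_prod]
    rw [h1]
    exact Finset.prod_le_prod (fun i _ => abs_nonneg _) (fun i _ => h i _)
  refine (Finset.sum_le_sum fun σ _ => key σ).trans ?_
  simp [Fintype.card_perm]

theorem Matrix.abs_mulVec_le {k m : ℕ} (A : Matrix (Fin k) (Fin m) ℝ) (v : Fin m → ℝ) (R : ℝ)
    (hA : ∀ i j, |A i j| ≤ 1) (hv : ∀ j, |v j| ≤ R) (i : Fin k) :
    |A.mulVec v i| ≤ m * R := by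
  unfold Matrix.mulVec dotProduct
  refine (Finset.abs_sum_le_sum_abs _ _).trans ?_
  have : ∀ j ∈ Finset.univ, |A i j * v j| ≤ R := fun j _ => by
    rw [abs_mul]
    calc |A i j| * |v j| ≤ 1 * |v j| := by gcongr; exact hA i j
      _ ≤ R := by rw [one_mul]; exact hv j
  simpa using Finset.sum_le_sum this

theorem exists_orthogonal_mulVec_eq_zero {m : ℕ} (f : Fin m → Fin m → ℝ) :
    ∃ U : Matrix (Fin m) (Fin m) ℝ, U * U.transpose = 1 ∧ (∀ i l, |U i l| ≤ 1) ∧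
      ∀ i l, i < l → U.mulVec (f i) l = 0 := by
  have hE : Module.finrank ℝ (EuclideanSpace ℝ (Fin m)) = Fintype.card (Fin m) := by simp
  have hz := fun i l (h : i < l) =>
    InnerProductSpace.gramSchmidtOrthonormalBasis_inv_triangular (𝕜 := ℝ) hE
      (f := fun i => WithLp.toLp 2 (f i)) h
  generalize InnerProductSpace.gramSchmidtOrthonormalBasis hE _ = e at hz
  refine ⟨Matrix.of fun i l => e i l, ?_, fun i l => ?_, fun i l h => ?_⟩
  · ext i l
    have := (orthonormal_iff_ite.mp e.orthonormal) l i
    rw [PiLp.inner_apply] at this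
    rw [Matrix.mul_apply, Matrix.one_apply]
    simpa [eq_comm] using this
  · have := PiLp.norm_apply_le (e i) l
    rwa [e.orthonormal.1 i, Real.norm_eq_abs] at this
  · rw [← hz i l h, PiLp.inner_apply]
    simp [Matrix.mulVec, dotProduct, mul_comm]

theorem exists_det_append_eq_mul (j k : ℕ) (a : Fin j → Fin (j + k) → ℝ) :
    ∃ (A : Matrix (Fin j) (Fin (j + k)) ℝ) (B : Matrix (Fin k) (Fin (j + k)) ℝ),
      (∀ i l, |A i l| ≤ 1) ∧ (∀ i l, |B i l| ≤ 1) ∧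
      ∀ b : Fin k → Fin (j + k) → ℝ,
        |(Matrix.of (Fin.append a b)).det| =
          |(Matrix.of fun i => A.mulVec (a i)).det| *
            |(Matrix.of fun i => B.mulVec (b i)).det| := by
  obtain ⟨U, hUU, hU, hz'⟩ := exists_orthogonal_mulVec_eq_zero (Fin.append a 0)
  have hdet : |U.transpose.det| = 1 := by
    have := congrArg Matrix.det hUU
    rw [Matrix.det_mul, Matrix.det_transpose, Matrix.det_one] at this
    rw [Matrix.det_transpose]
    have h2 : |U.det| * |U.det| = 1 := by rw [← abs_mul, this, abs_one]
    nlinarith [abs_nonneg U.det]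
  have hz : ∀ i l, U.mulVec (a i) (Fin.natAdd j l) = 0 := fun i l => by
    have hlt : Fin.castAdd k i < Fin.natAdd j l := by
      rw [Fin.lt_def]; simp; omega
    simpa using hz' _ _ hlt
  refine ⟨Matrix.of fun i => U (Fin.castAdd k i), Matrix.of fun i => U (Fin.natAdd j i),
    fun i l => hU _ _, fun i l => hU _ _, fun b => ?_⟩
  have h4 : |(Matrix.of (Fin.append a b)).det| =
      |(Matrix.of (Fin.append a b) * U.transpose).det| := by
    rw [Matrix.det_mul, abs_mul, hdet, mul_one]
  rw [h4, ← Matrix.det_submatrix_equiv_self (finSumFinEquiv (m := j) (n := k)), ← abs_mul,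
    ← Matrix.det_fromBlocks_zero₁₂ _ (Matrix.of fun i l => U.mulVec (b i) (Fin.castAdd k l))]
  congr 2
  have hmul : ∀ x y, (Matrix.of (Fin.append a b) * U.transpose) x y =
      U.mulVec (Fin.append a b x) y := fun x y => dotProduct_comm _ _
  ext x y
  rcases x with x | x <;> rcases y with y | y <;>
    simp only [Matrix.submatrix_apply, hmul, finSumFinEquiv_apply_left,
      finSumFinEquiv_apply_right, Fin.append_left, Fin.append_right, Matrix.fromBlocks_apply₁₁,
      Matrix.fromBlocks_apply₁₂, Matrix.fromBlocks_apply₂₁, Matrix.fromBlocks_apply₂₂, hz]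
  all_goals rfl

theorem exists_eq_smul_insertNth (m : ℕ) (v : Fin (m + 1) → ℝ) (R : ℝ) (hv : ∀ i, |v i| ≤ R) :
    ∃ (s : ℝ) (c : Fin (m + 1)) (p : Fin m → ℝ), |s| ≤ R ∧ (∀ i, |p i| ≤ 1) ∧
      v = s • (c.insertNth (α := fun _ => ℝ) 1 p) := by
  obtain ⟨c, hc⟩ := Finite.exists_max fun i => |v i|
  refine ⟨v c, c, fun i => v (c.succAbove i) / v c, hv c, fun i => ?_, ?_⟩
  · rw [abs_div]
    exact div_le_one_of_le₀ (hc _) (abs_nonneg _)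
  · by_cases h0 : v c = 0
    · ext i
      have := hc i
      simp only [h0, abs_zero] at this
      simp [h0, abs_nonpos_iff.mp this]
    · rw [← Fin.insertNth_self_removeNth c v]
      ext i
      refine Fin.succAboveCases c ?_ (fun i => ?_) i
      · simp
      · simp [Fin.removeNth]
        field_simp

theorem exists_close_subset {ι κ : Type*} [Fintype κ] (m t : ℕ) (S : Finset ι) (c : ι → κ)
    (p : ι → Fin m → ℝ) (hp : ∀ x ∈ S, ∀ i, |p x i| ≤ 1) (ε : ℝ) (h0 : 0 < ε) (h1 : ε ≤ 1)
    (h : t * (Fintype.card κ * (4 / ε) ^ m) < S.card) :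
    ∃ T ⊆ S, T.card = t + 1 ∧ (∀ x ∈ T, ∀ y ∈ T, c x = c y) ∧
      ∀ x ∈ T, ∀ y ∈ T, ∀ i, |p x i - p y i| ≤ ε := by
  classical
  set N := ⌊2 / ε⌋₊ + 1 with hN
  have hNle : (N : ℝ) ≤ 4 / ε := by
    have h2 := Nat.floor_le (a := 2 / ε) (by positivity)
    have h3 : 1 ≤ 1 / ε := by rw [le_div_iff₀ h0]; linarith
    have h4 : 4 / ε = 2 / ε + 2 * (1 / ε) := by ring
    push_cast [hN]
    linarith
  let g : ι → κ × (Fin m → ℕ) := fun x => (c x, fun i => ⌊(p x i + 1) / ε⌋₊)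
  let G : Finset (κ × (Fin m → ℕ)) :=
    Finset.univ ×ˢ Fintype.piFinset fun _ => Finset.range N
  have hG : (G.card : ℝ) ≤ Fintype.card κ * (4 / ε) ^ m := by
    have : G.card = Fintype.card κ * N ^ m := by simp [G, Finset.card_product]
    rw [this]
    push_cast
    gcongr
  have hg : ∀ x ∈ S, g x ∈ G := fun x hx => by
    simp only [g, G, Finset.mem_product, Finset.mem_univ, true_and, Fintype.mem_piFinset,
      Finset.mem_range]
    intro i
    rw [hN, Nat.lt_succ_iff]
    have := abs_le.mp (hp x hx i)
    gcongr
    linarith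
  have hlt : G.card * t < S.card := by
    have : (G.card * t : ℝ) < S.card := lt_of_le_of_lt (by rw [mul_comm]; gcongr) h
    exact_mod_cast this
  obtain ⟨y, -, hy⟩ := Finset.exists_lt_card_fiber_of_mul_lt_card_of_maps_to hg hlt
  obtain ⟨T, hT, hTc⟩ := Finset.exists_subset_card_eq (Nat.succ_le_of_lt hy)
  have hTg : ∀ x ∈ T, x ∈ S ∧ g x = y := fun x hx => Finset.mem_filter.mp (hT hx)
  refine ⟨T, fun x hx => (hTg x hx).1, hTc, fun x hx z hz => ?_, fun x hx z hz i => ?_⟩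
  · exact congrArg Prod.fst ((hTg x hx).2.trans (hTg z hz).2.symm)
  · have heq := congrFun (congrArg Prod.snd ((hTg x hx).2.trans (hTg z hz).2.symm)) i
    simp only [g] at heq
    have hx1 := abs_le.mp (hp x (hTg x hx).1 i)
    have hz1 := abs_le.mp (hp z (hTg z hz).1 i)
    have a1 := Nat.floor_le (a := (p x i + 1) / ε) (div_nonneg (by linarith) h0.le)
    have a2 := Nat.lt_floor_add_one ((p x i + 1) / ε)
    have b1 := Nat.floor_le (a := (p z i + 1) / ε) (div_nonneg (by linarith) h0.le)
    have b2 := Nat.lt_floor_add_one ((p z i + 1) / ε)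
    rw [heq] at a1 a2
    rw [le_div_iff₀ h0] at a1 b1
    rw [div_lt_iff₀ h0] at a2 b2
    rw [abs_le]
    constructor <;> nlinarith

theorem exists_disjoint_pairs {α : Type*} [DecidableEq α] (r : α → α → Prop) (L M : ℕ)
    (S : Finset α) (hS : L + 2 * M ≤ S.card)
    (h : ∀ T ⊆ S, L < T.card → ∃ x ∈ T, ∃ y ∈ T, x ≠ y ∧ r x y) :
    ∃ P : Finset (α × α), P.card = M ∧
      (∀ p ∈ P, p.1 ∈ S ∧ p.2 ∈ S ∧ p.1 ≠ p.2 ∧ r p.1 p.2) ∧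
      ∀ p ∈ P, ∀ q ∈ P, p ≠ q → p.1 ≠ q.1 ∧ p.1 ≠ q.2 ∧ p.2 ≠ q.1 ∧ p.2 ≠ q.2 := by
  induction M generalizing S with
  | zero => exact ⟨∅, by simp⟩
  | succ M ih =>
    obtain ⟨x, hx, y, hy, hxy, hr⟩ := h S subset_rfl (by omega)
    have hc : (S \ {x, y}).card = S.card - 2 := by
      rw [Finset.card_sdiff_of_subset (by grind), Finset.card_pair hxy]
    obtain ⟨P, hPc, hP, hd⟩ := ih (S \ {x, y}) (by omega)
      (fun T hT => h T (hT.trans Finset.sdiff_subset))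
    have hP' : ∀ p ∈ P, p.1 ∈ S ∧ p.2 ∈ S ∧ p.1 ≠ x ∧ p.1 ≠ y ∧ p.2 ≠ x ∧ p.2 ≠ y := by
      intro p hp
      have := hP p hp
      simp only [Finset.mem_sdiff, Finset.mem_insert, Finset.mem_singleton] at this
      tauto
    refine ⟨insert (x, y) P, ?_, ?_, ?_⟩
    · rw [Finset.card_insert_of_notMem fun hm => (hP' _ hm).2.2.1 rfl, hPc]
    · intro p hp
      rcases Finset.mem_insert.mp hp with rfl | hp
      · exact ⟨hx, hy, hxy, hr⟩
      · exact ⟨(hP' p hp).1, (hP' p hp).2.1, (hP p hp).2.2⟩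
    · intro p hp q hq hpq
      rcases Finset.mem_insert.mp hp with rfl | hp <;> rcases Finset.mem_insert.mp hq with rfl | hq
      · exact absurd rfl hpq
      · have := hP' q hq
        grind
      · have := hP' p hp
        grind
      · exact hd p hp q hq hpq

theorem abs_insertNth_le {m : ℕ} (c : Fin (m + 1)) (a : ℝ) (p : Fin m → ℝ) (ha : |a| ≤ 1)
    (hp : ∀ i, |p i| ≤ 1) (i : Fin (m + 1)) : |c.insertNth (α := fun _ => ℝ) a p i| ≤ 1 := by
  refine Fin.succAboveCases c ?_ (fun i => ?_) i
  · simpa using ha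
  · simpa using hp i

theorem det_four_of_parallel_pairs (q θ q' η : Fin 4 → ℝ) (s₀ s₁ s₂ s₃ σ σ' ε : ℝ) :
    (Matrix.of ![s₀ • q, s₁ • (q + σ • θ), s₂ • q', s₃ • (q' + σ' • (θ + ε • η))]).det =
      s₀ * s₁ * s₂ * s₃ * (σ * σ') * ε * (Matrix.of ![q, θ, q', η]).det := by
  simp [Matrix.det_succ_row_zero, Fin.sum_univ_succ, Fin.succAbove]
  ring

theorem injective_vec_four {α : Type*} {a b c d : α} (hab : a ≠ b) (hac : a ≠ c) (had : a ≠ d)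
    (hbc : b ≠ c) (hbd : b ≠ d) (hcd : c ≠ d) : Function.Injective ![a, b, c, d] := by
  have h : (![a, b, c, d] : Fin 4 → α) =
      Fin.cons a (Fin.cons b (Fin.cons c (Fin.cons d Fin.elim0))) := by
    ext i
    fin_cases i <;> rfl
  rw [h]
  simp [Fin.cons_injective_iff, *, Ne.symm, Function.injective_of_subsingleton]

theorem exists_four_abs_det_le {ι : Type*} [DecidableEq ι] (S : Finset ι) (v : ι → Fin 6 → ℝ)
    (R : ℝ) (hv : ∀ x ∈ S, ∀ i, |v x i| ≤ R) (L M : ℕ) (ε δ : ℝ) (hε : 0 < ε) (hε1 : ε ≤ 1)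
    (hδ : 0 < δ) (hδ1 : δ ≤ 1) (hL : 6 * (4 / ε) ^ 5 ≤ L) (hM : 30 * (4 / δ) ^ 4 < M)
    (hS : L + 2 * M ≤ S.card) :
    ∃ y : Fin 4 → ι, Function.Injective y ∧ (∀ i, y i ∈ S) ∧
      ∀ A : Matrix (Fin 4) (Fin 6) ℝ, (∀ i l, |A i l| ≤ 1) →
        |(Matrix.of fun i => A.mulVec (v (y i))).det| ≤ 31104 * R ^ 4 * ε ^ 2 * δ := by
  choose! s c p hs hp hvs using fun x (hx : x ∈ S) => exists_eq_smul_insertNth 5 (v x) R (hv x hx)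
  obtain ⟨P, hPc, hP, hdisj⟩ := exists_disjoint_pairs
    (fun x y => c x = c y ∧ ∀ i, |p y i - p x i| ≤ ε) L M S hS (by
      intro T hT hLT
      have hlt : ((1 : ℕ) : ℝ) * (Fintype.card (Fin 6) * (4 / ε) ^ 5) < T.card := by
        have : (L : ℝ) < T.card := by exact_mod_cast hLT
        simp only [Fintype.card_fin]
        push_cast
        linarith
      obtain ⟨Q, hQ, hQc, hc, hd⟩ := exists_close_subset 5 1 T c p
        (fun x hx => hp x (hT hx)) ε hε hε1 hlt
      obtain ⟨x, y, hxy, rfl⟩ := Finset.card_eq_two.mp hQc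
      exact ⟨x, hQ (by simp), y, hQ (by simp), hxy, hc _ (by simp) _ (by simp),
        hd _ (by simp) _ (by simp)⟩)
  choose! σ c' r hσ hr hpr using fun (w : ι × ι) (hw : w ∈ P) =>
    exists_eq_smul_insertNth 4 (p w.2 - p w.1) ε (fun i => (hP w hw).2.2.2.2 i)
  have hlt : ((1 : ℕ) : ℝ) * (Fintype.card (Fin 6 × Fin 5) * (4 / δ) ^ 4) < P.card := by
    rw [hPc]
    simp only [Fintype.card_prod, Fintype.card_fin]
    push_cast
    linarith
  obtain ⟨Q, hQ, hQc, hc, hd⟩ := exists_close_subset 4 1 P (fun w => (c w.1, c' w)) r hr δ hδ hδ1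
    hlt
  obtain ⟨w, z, hwz, rfl⟩ := Finset.card_eq_two.mp hQc
  have hw : w ∈ P := hQ (by simp)
  have hz : z ∈ P := hQ (by simp)
  have hcwz := hc w (by simp) z (by simp)
  simp only [Prod.mk.injEq] at hcwz
  have hdr := hd z (by simp) w (by simp)
  have hne := hdisj w hw z hz hwz
  obtain ⟨hw1, hw2, hw12, hwc, -⟩ := hP w hw
  obtain ⟨hz1, hz2, hz12, hzc, -⟩ := hP z hz
  refine ⟨![w.1, w.2, z.1, z.2], injective_vec_four hw12 hne.1 hne.2.1 hne.2.2.1 hne.2.2.2 hz12,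
    ?_, fun A hA => ?_⟩
  · intro i
    fin_cases i
    exacts [hw1, hw2, hz1, hz2]
  · let q : Fin 6 → ℝ := (c w.1).insertNth (α := fun _ => ℝ) 1 (p w.1)
    let q' : Fin 6 → ℝ := (c w.1).insertNth (α := fun _ => ℝ) 1 (p z.1)
    let θ : Fin 6 → ℝ := (c w.1).insertNth (α := fun _ => ℝ) 0
      ((c' w).insertNth (α := fun _ => ℝ) 1 (r w))
    let η : Fin 6 → ℝ := (c w.1).insertNth (α := fun _ => ℝ) 0
      ((c' w).insertNth (α := fun _ => ℝ) 0 (fun i => (r z i - r w i) / δ))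
    have e0 : v w.1 = s w.1 • q := hvs _ hw1
    have e1 : v w.2 = s w.2 • (q + σ w • θ) := by
      rw [hvs _ hw2, ← hwc]
      congr 1
      ext i
      refine Fin.succAboveCases (c w.1) ?_ (fun i => ?_) i
      · simp [q, θ]
      · have := congrFun (hpr w hw) i
        simp only [Pi.sub_apply, Pi.smul_apply, smul_eq_mul] at this
        simp [q, θ, ← this]
    have e2 : v z.1 = s z.1 • q' := by
      rw [hvs _ hz1, ← hcwz.1]
    have e3 : v z.2 = s z.2 • (q' + σ z • (θ + δ • η)) := by
      rw [hvs _ hz2, ← hzc, ← hcwz.1]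
      congr 1
      ext i
      refine Fin.succAboveCases (c w.1) ?_ (fun i => ?_) i
      · simp [q', θ, η]
      · have h1 : p z.2 i = p z.1 i + σ z * (c' w).insertNth (α := fun _ => ℝ) 1 (r z) i := by
          have := congrFun (hpr z hz) i
          simp only [Pi.sub_apply, Pi.smul_apply, smul_eq_mul] at this
          rw [hcwz.2, ← this]
          ring
        have h2 : (c' w).insertNth (α := fun _ => ℝ) 1 (r z) i =
            (c' w).insertNth (α := fun _ => ℝ) 1 (r w) i + δ *
            (c' w).insertNth (α := fun _ => ℝ) 0 (fun i => (r z i - r w i) / δ) i := by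
          refine Fin.succAboveCases (c' w) ?_ (fun i => ?_) i
          · simp
          · simp
            field_simp
            ring
        simp [q', θ, η, h1, h2, mul_add]
    have hq := abs_insertNth_le (c w.1) 1 (p w.1) (by simp) (hp _ hw1)
    have hq' := abs_insertNth_le (c w.1) 1 (p z.1) (by simp) (hp _ hz1)
    have hθ := abs_insertNth_le (c w.1) 0 _ (by simp)
      (abs_insertNth_le (c' w) 1 (r w) (by simp) (hr w hw))
    have hη := abs_insertNth_le (c w.1) 0 _ (by simp)
      (abs_insertNth_le (c' w) 0 (fun i => (r z i - r w i) / δ) (by simp) (fun i => by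
        rw [abs_div, abs_of_pos hδ]
        exact div_le_one_of_le₀ (hdr i) hδ.le))
    have hmat : (Matrix.of fun i => A.mulVec (v ((![w.1, w.2, z.1, z.2] : Fin 4 → ι) i))) =
        Matrix.of ![s w.1 • A.mulVec q, s w.2 • (A.mulVec q + σ w • A.mulVec θ),
          s z.1 • A.mulVec q',
          s z.2 • (A.mulVec q' + σ z • (A.mulVec θ + δ • A.mulVec η))] := by
      ext i j
      fin_cases i <;> simp [e0, e1, e2, e3, Matrix.mulVec_add, Matrix.mulVec_smul]
    have hdet : |(Matrix.of ![A.mulVec q, A.mulVec θ, A.mulVec q', A.mulVec η]).det| ≤ 31104 := by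
      refine (Matrix.abs_det_le_factorial_mul_prod _ (fun _ => 6) fun i j => ?_).trans ?_
      · fin_cases i
        · simpa using Matrix.abs_mulVec_le A q 1 hA hq j
        · simpa using Matrix.abs_mulVec_le A θ 1 hA hθ j
        · simpa using Matrix.abs_mulVec_le A q' 1 hA hq' j
        · simpa using Matrix.abs_mulVec_le A η 1 hA hη j
      · norm_num [Nat.factorial]
    rw [hmat, det_four_of_parallel_pairs]
    simp only [abs_mul, abs_of_pos hδ]
    have hR : 0 ≤ R := (abs_nonneg _).trans (hs _ hw1)
    calc _ ≤ R * R * R * R * (ε * ε) * δ * 31104 := by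
          gcongr
          exacts [hs _ hw1, hs _ hw2, hs _ hz1, hs _ hz2, hσ w hw, hσ z hz]
      _ = _ := by ring

theorem exists_two_abs_det_le {ι : Type*} [DecidableEq ι] (S : Finset ι) (v : ι → Fin 2 → ℝ)
    (R : ℝ) (hv : ∀ x ∈ S, ∀ i, |v x i| ≤ R) (ε : ℝ) (hε : 0 < ε) (hε1 : ε ≤ 1)
    (hS : 8 / ε < S.card) :
    ∃ y : Fin 2 → ι, Function.Injective y ∧ (∀ i, y i ∈ S) ∧
      |(Matrix.of fun i => v (y i)).det| ≤ R ^ 2 * ε := by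
  choose! s c p hs hp hvs using fun x (hx : x ∈ S) => exists_eq_smul_insertNth 1 (v x) R (hv x hx)
  have hlt : ((1 : ℕ) : ℝ) * (Fintype.card (Fin 2) * (4 / ε) ^ 1) < S.card := by
    rw [Fintype.card_fin]
    push_cast
    convert hS using 1
    ring
  obtain ⟨Q, hQ, hQc, hc, hd⟩ := exists_close_subset 1 1 S c p hp ε hε hε1 hlt
  obtain ⟨x, y, hxy, rfl⟩ := Finset.card_eq_two.mp hQc
  have hx : x ∈ S := hQ (by simp)
  have hy : y ∈ S := hQ (by simp)
  have hcxy := hc x (by simp) y (by simp)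
  refine ⟨![x, y], ?_, ?_, ?_⟩
  · intro i j hij
    fin_cases i <;> fin_cases j <;> simp_all
  · intro i
    fin_cases i <;> simp_all
  · have key : |(Matrix.of fun i => v ((![x, y] : Fin 2 → ι) i)).det| =
        |s x| * |s y| * |p x 0 - p y 0| := by
      rw [Matrix.det_fin_two, ← abs_mul, ← abs_mul]
      simp only [Matrix.of_apply, Matrix.cons_val_zero, Matrix.cons_val_one]
      rw [hvs x hx, hvs y hy, ← hcxy]
      obtain h | h := (show ∀ t : Fin 2, t = 0 ∨ t = 1 by decide) (c x)
      · rw [h, ← abs_neg]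
        simp [-abs_mul, Fin.insertNth_zero']
        congr 1
        ring
      · rw [h]
        have h0 : ∀ t : Fin 1 → ℝ, (1 : Fin 2).insertNth (α := fun _ => ℝ) 1 t 0 = t 0 :=
          fun t => Fin.insertNth_apply_succAbove (α := fun _ => ℝ) (1 : Fin 2) 1 t 0
        simp [-abs_mul, h0]
        congr 1
        ring
    have hR : 0 ≤ R := (abs_nonneg _).trans (hs _ hx)
    rw [key, sq]
    gcongr
    exacts [hs _ hx, hs _ hy, hd x (by simp) y (by simp) 0]

theorem exists_simplex_abs_det_le (X : Finset (EuclideanSpace ℝ (Fin 8)))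
    (hX : ∀ x ∈ X, ∀ i, x i ∈ Set.Icc (0 : ℝ) 1) (hn : 12 ≤ X.card) (ε₁ ε₂ ε₃ ε₄ : ℝ)
    (h₁ : 0 < ε₁) (h₁' : ε₁ ≤ 1) (h₂ : 0 < ε₂) (h₂' : ε₂ ≤ 1) (h₃ : 0 < ε₃) (h₃' : ε₃ ≤ 1)
    (h₄ : 0 < ε₄) (h₄' : ε₄ ≤ 1) (hc₁ : 2 * (4 / ε₁) ^ 8 < X.card)
    (hc₂ : 6 * (4 / ε₂) ^ 5 ≤ (X.card / 4 : ℕ)) (hc₃ : 30 * (4 / ε₃) ^ 4 < (X.card / 4 : ℕ))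
    (hc₄ : 8 / ε₄ < X.card - 7) :
    ∃ p : Fin 9 → EuclideanSpace ℝ (Fin 8), Function.Injective p ∧ (∀ i, p i ∈ X) ∧
      |(Matrix.of fun i : Fin 8 => (p i.succ - p 0).ofLp).det| ≤
        128 * 31104 * 4096 * 2304 * (ε₁ ^ 2 * (ε₂ ^ 2 * ε₃ * ε₄)) := by
  classical
  obtain ⟨T, hT, hTc, -, hTd⟩ := exists_close_subset 8 2 X (fun _ => ()) (fun x i => x i)
    (fun x hx i => abs_le.mpr ⟨by linarith [(hX x hx i).1], (hX x hx i).2⟩) ε₁ h₁ h₁'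
    (by simpa using hc₁)
  obtain ⟨x₀, x₁, x₂, h01, h02, h12, rfl⟩ := Finset.card_eq_three.mp hTc
  have hx₀ : x₀ ∈ X := hT (by simp)
  have hx₁ : x₁ ∈ X := hT (by simp)
  have hx₂ : x₂ ∈ X := hT (by simp)
  let a : Fin 2 → Fin 8 → ℝ := ![(x₁ - x₀).ofLp, (x₂ - x₀).ofLp]
  obtain ⟨A, B, hA, hB, hAB⟩ := exists_det_append_eq_mul 2 6 a
  have hdetA : |(Matrix.of fun i => A.mulVec (a i)).det| ≤ 128 * ε₁ ^ 2 := by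
    refine (Matrix.abs_det_le_factorial_mul_prod _ (fun _ => (8 : ℕ) * ε₁) fun i j => ?_).trans ?_
    · refine Matrix.abs_mulVec_le A (a i) ε₁ hA (fun l => ?_) j
      fin_cases i
      · exact hTd x₁ (by simp) x₀ (by simp) l
      · exact hTd x₂ (by simp) x₀ (by simp) l
    · simp [Finset.prod_const]
      apply le_of_eq
      ring
  let v : EuclideanSpace ℝ (Fin 8) → Fin 6 → ℝ := fun x => B.mulVec (x - x₀).ofLp
  have hv : ∀ x ∈ X, ∀ i, |v x i| ≤ 8 := fun x hx i => by
    have := Matrix.abs_mulVec_le B (x - x₀).ofLp 1 hB (fun l => by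
      have h1 := hX x hx l
      have h2 := hX x₀ hx₀ l
      rw [PiLp.sub_apply, abs_le]
      constructor <;> linarith [h1.1, h1.2, h2.1, h2.2]) i
    norm_num at this
    exact this
  have hS : X.card / 4 + 2 * (X.card / 4) ≤ (X \ {x₀, x₁, x₂}).card := by
    rw [Finset.card_sdiff_of_subset hT, hTc]
    omega
  obtain ⟨y, hyi, hyX, hydet⟩ := exists_four_abs_det_le (X \ {x₀, x₁, x₂}) v 8
    (fun x hx => hv x (Finset.mem_sdiff.mp hx).1) _ _ ε₂ ε₃ h₂ h₂' h₃ h₃' hc₂ hc₃ hS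
  obtain ⟨A', B', hA', hB', hAB'⟩ := exists_det_append_eq_mul 4 2 fun i => v (y i)
  let u : EuclideanSpace ℝ (Fin 8) → Fin 2 → ℝ := fun x => B'.mulVec (v x)
  have hu : ∀ x ∈ X, ∀ i, |u x i| ≤ 48 := fun x hx i => by
    have := Matrix.abs_mulVec_le B' (v x) 8 hB' (hv x hx) i
    norm_num at this
    exact this
  let S := (X \ {x₀, x₁, x₂}) \ Finset.univ.image y
  have hS2 : 8 / ε₄ < S.card := by
    have h : S.card = X.card - 7 := by
      rw [Finset.card_sdiff_of_subset (Finset.image_subset_iff.mpr fun i _ => hyX i),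
        Finset.card_sdiff_of_subset hT, hTc, Finset.card_image_of_injective _ hyi]
      simp
      omega
    rw [h, Nat.cast_sub (by omega)]
    exact_mod_cast hc₄
  have hSX : ∀ x ∈ S, x ∈ X ∧ x ≠ x₀ ∧ x ≠ x₁ ∧ x ≠ x₂ ∧ ∀ i, y i ≠ x := fun x hx => by
    simpa [S, and_assoc] using hx
  obtain ⟨z, hzi, hzS, hzdet⟩ := exists_two_abs_det_le S u 48 (fun x hx => hu x (hSX x hx).1) ε₄
    h₄ h₄' hS2
  have hyX' : ∀ i, y i ∈ X ∧ y i ≠ x₀ ∧ y i ≠ x₁ ∧ y i ≠ x₂ := fun i => by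
    simpa using hyX i
  let w : Fin (2 + (4 + 2)) → EuclideanSpace ℝ (Fin 8) :=
    Fin.append ![x₁, x₂] (Fin.append y z)
  have hw : ∀ i, w i ∈ X ∧ w i ≠ x₀ := by
    refine Fin.addCases (fun i => ?_) fun i => ?_
    · simp only [w, Fin.append_left]
      fin_cases i
      exacts [⟨hx₁, h01.symm⟩, ⟨hx₂, h02.symm⟩]
    · simp only [w, Fin.append_right]
      refine Fin.addCases (fun i => ?_) (fun i => ?_) i
      · simp only [Fin.append_left]
        exact ⟨(hyX' i).1, (hyX' i).2.1⟩
      · simp only [Fin.append_right]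
        exact ⟨(hSX _ (hzS i)).1, (hSX _ (hzS i)).2.1⟩
  have hwi : Function.Injective w := by
    refine Fin.append_injective_iff.mpr ⟨?_, Fin.append_injective_iff.mpr ⟨hyi, hzi, ?_⟩, ?_⟩
    · intro i j hij
      fin_cases i <;> fin_cases j <;> simp_all
    · exact fun i j => (hSX _ (hzS j)).2.2.2.2 i
    · intro i
      refine Fin.addCases (fun j => ?_) fun j => ?_
      · rw [Fin.append_left]
        fin_cases i
        exacts [(hyX' j).2.2.1.symm, (hyX' j).2.2.2.symm]
      · rw [Fin.append_right]
        fin_cases i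
        exacts [(hSX _ (hzS j)).2.2.1.symm, (hSX _ (hzS j)).2.2.2.1.symm]
  refine ⟨Fin.cons x₀ w, ?_, ?_, ?_⟩
  · rw [Fin.cons_injective_iff]
    refine ⟨?_, hwi⟩
    rintro ⟨i, hi⟩
    exact (hw i).2 hi
  · exact Fin.cases hx₀ fun i => (hw i).1
  · have hrow : (fun i : Fin 8 => ((Fin.cons x₀ w : Fin 9 → EuclideanSpace ℝ (Fin 8)) i.succ -
        (Fin.cons x₀ w : Fin 9 → EuclideanSpace ℝ (Fin 8)) 0).ofLp) =
        Fin.append a (Fin.append (fun i => (y i - x₀).ofLp) fun i => (z i - x₀).ofLp) := by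
      ext i
      fin_cases i <;> rfl
    have hrow' : (fun i : Fin 6 => B.mulVec ((Fin.append (fun i : Fin 4 => (y i - x₀).ofLp)
        fun i : Fin 2 => (z i - x₀).ofLp) i)) =
        Fin.append (fun i => v (y i)) fun i => v (z i) := by
      ext i
      fin_cases i <;> rfl
    rw [hrow]
    refine (hAB _).trans_le ?_
    rw [hrow']
    have h6 := hAB' fun i => v (z i)
    calc _ ≤ 128 * ε₁ ^ 2 * ((31104 * 8 ^ 4 * ε₂ ^ 2 * ε₃) * (48 ^ 2 * ε₄)) := by
          gcongr
          rw [h6]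
          gcongr
          · exact hydet A' hA'
      _ = _ := by ring

theorem vol_eq_abs_det {d : ℕ} (v : Fin d → EuclideanSpace ℝ (Fin d)) :
    vol v = |(Matrix.of fun i => (v i).ofLp).det| := by
  have h : gram v = (Matrix.of fun i => (v i).ofLp) * (Matrix.of fun i => (v i).ofLp).transpose := by
    ext i j
    simp [gram, Matrix.mul_apply, PiLp.inner_apply, mul_comm]
  rw [vol, h, Matrix.det_mul, Matrix.det_transpose, Real.sqrt_mul_self_eq_abs]

theorem minSimplexVol_le {d k : ℕ} (X : Finset (EuclideanSpace ℝ (Fin d)))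
    (p : Fin (k + 1) → EuclideanSpace ℝ (Fin d)) (hp : Function.Injective p) (hX : ∀ i, p i ∈ X) :
    minSimplexVol d k X ≤ vol fun i : Fin k => p i.succ - p 0 := by
  have h0 : ∀ q : Fin k → EuclideanSpace ℝ (Fin d), 0 ≤ vol q := fun q => Real.sqrt_nonneg _
  suffices hle : minSimplexVol d k X ≤ simplexVol p by
    refine hle.trans (mul_le_of_le_one_left (h0 _) (inv_le_one_of_one_le₀ ?_))
    exact_mod_cast Nat.one_le_iff_ne_zero.mpr (Nat.factorial_ne_zero k)
  refine csInf_le ⟨0, ?_⟩ ⟨p, hp, hX, rfl⟩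
  rintro _ ⟨q, -, -, rfl⟩
  exact mul_nonneg (by positivity) (h0 _)

theorem four_div_mul_rpow_pow {x : ℝ} (hx : 0 < x) (m : ℕ) (hm : m ≠ 0) :
    (4 / (200 * x ^ (-(1 / (m : ℝ))))) ^ m = (1 / 50) ^ m * x := by
  have h : (x ^ (1 / (m : ℝ))) ^ m = x := by
    rw [one_div]
    exact Real.rpow_inv_natCast_pow hx.le hm
  rw [Real.rpow_neg hx.le]
  conv_rhs => rw [← h, ← mul_pow]
  congr 1
  field_simp
  norm_num

theorem mul_rpow_le_one {x : ℝ} (hx : (200 : ℝ) ^ 8 ≤ x) (m : ℕ) (hm : m ≠ 0) (hm8 : m ≤ 8) :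
    200 * x ^ (-(1 / (m : ℝ))) ≤ 1 := by
  have hx0 : 0 < x := lt_of_lt_of_le (by positivity) hx
  have h : (200 : ℝ) ≤ x ^ (1 / (m : ℝ)) := by
    rw [one_div]
    refine (Real.le_rpow_inv_iff_of_pos (by norm_num) hx0.le (by positivity)).mpr ?_
    rw [Real.rpow_natCast]
    exact (pow_le_pow_right₀ (by norm_num) hm8).trans hx
  rw [Real.rpow_neg hx0.le, mul_inv_le_iff₀ (Real.rpow_pos_of_pos hx0 _)]
  linarith

theorem minSimplexVol_le_mul_rpow (X : Finset (EuclideanSpace ℝ (Fin 8)))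
    (hX : ∀ x ∈ X, ∀ i, x i ∈ Set.Icc (0 : ℝ) 1) (hn : 200 ^ 8 ≤ X.card) :
    minSimplexVol 8 8 X ≤
      128 * 31104 * 4096 * 2304 * 200 ^ 6 * (X.card : ℝ) ^ (-(19 / 10) : ℝ) := by
  set x : ℝ := (X.card : ℝ) with hx
  have hx8 : (200 : ℝ) ^ 8 ≤ x := by rw [hx]; exact_mod_cast hn
  have hx0 : 0 < x := lt_of_lt_of_le (by positivity) hx8
  have hpos : ∀ m : ℕ, 0 < 200 * x ^ (-(1 / (m : ℝ))) := fun m => by positivity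
  have hdiv : x / 4 - 1 ≤ ((X.card / 4 : ℕ) : ℝ) := by
    have : X.card ≤ 4 * (X.card / 4) + 3 := by omega
    have : x ≤ 4 * ((X.card / 4 : ℕ) : ℝ) + 3 := by rw [hx]; exact_mod_cast this
    linarith
  have e1 := four_div_mul_rpow_pow hx0 8 (by norm_num)
  have e2 := four_div_mul_rpow_pow hx0 5 (by norm_num)
  have e3 := four_div_mul_rpow_pow hx0 4 (by norm_num)
  have e4 := four_div_mul_rpow_pow hx0 1 (by norm_num)
  obtain ⟨p, hp, hpX, hdet⟩ := exists_simplex_abs_det_le X hX (le_trans (by norm_num) hn)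
    (200 * x ^ (-(1 / ((8 : ℕ) : ℝ)))) (200 * x ^ (-(1 / ((5 : ℕ) : ℝ))))
    (200 * x ^ (-(1 / ((4 : ℕ) : ℝ)))) (200 * x ^ (-(1 / ((1 : ℕ) : ℝ))))
    (hpos 8) (mul_rpow_le_one hx8 8 (by norm_num) (by norm_num))
    (hpos 5) (mul_rpow_le_one hx8 5 (by norm_num) (by norm_num))
    (hpos 4) (mul_rpow_le_one hx8 4 (by norm_num) (by norm_num))
    (hpos 1) (mul_rpow_le_one hx8 1 (by norm_num) (by norm_num))
    (by rw [e1]; linarith) (by rw [e2]; linarith) (by rw [e3]; linarith)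
    (by
      rw [pow_one] at e4
      have : ∀ t : ℝ, 8 / t = 2 * (4 / t) := fun t => by ring
      rw [this, e4]
      linarith)
  refine (minSimplexVol_le X p hp hpX).trans ?_
  rw [vol_eq_abs_det]
  refine hdet.trans (le_of_eq ?_)
  have hpow : (x ^ (-(1 / ((8 : ℕ) : ℝ)))) ^ 2 * ((x ^ (-(1 / ((5 : ℕ) : ℝ)))) ^ 2 *
      x ^ (-(1 / ((4 : ℕ) : ℝ))) * x ^ (-(1 / ((1 : ℕ) : ℝ)))) = x ^ (-(19 / 10) : ℝ) := by
    rw [← Real.rpow_mul_natCast hx0.le, ← Real.rpow_mul_natCast hx0.le, ← Real.rpow_add hx0,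
      ← Real.rpow_add hx0, ← Real.rpow_add hx0]
    norm_num
  rw [← hpow]
  ring

theorem minSimplexVol_le_factorial {d : ℕ} (X : Finset (EuclideanSpace ℝ (Fin d)))
    (hX : ∀ x ∈ X, ∀ i, x i ∈ Set.Icc (0 : ℝ) 1) (hn : d + 1 ≤ X.card) :
    minSimplexVol d d X ≤ d.factorial := by
  obtain ⟨T, hT, hTc⟩ := Finset.exists_subset_card_eq hn
  let p : Fin (d + 1) → EuclideanSpace ℝ (Fin d) := fun i => (T.equivFinOfCardEq hTc).symm i
  have hp : Function.Injective p :=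
    Subtype.val_injective.comp (T.equivFinOfCardEq hTc).symm.injective
  have hpX : ∀ i, p i ∈ X := fun i => hT (Subtype.prop _)
  refine (minSimplexVol_le X p hp hpX).trans ?_
  rw [vol_eq_abs_det]
  refine (Matrix.abs_det_le_factorial_mul_prod _ (fun _ => 1) fun i j => ?_).trans (by simp)
  have h1 := hX _ (hpX i.succ) j
  have h2 := hX _ (hpX 0) j
  rw [Matrix.of_apply, PiLp.sub_apply, abs_le]
  constructor <;> linarith [h1.1, h1.2, h2.1, h2.2]

/-- **Corollary 2 (case d = 8).** There is a constant `C > 0` such that for every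
`n ≥ 9` one has `Δ_{8,8}(n) ≤ C · n^(-(19/10))`: every `n`-element subset of `[0,1]^8`
contains 9 points spanning a simplex of 8-dimensional volume at most `C · n^(-(19/10))`. -/
theorem delta_eight_eight :
    ∃ C : ℝ, 0 < C ∧ ∀ n : ℕ, 9 ≤ n →
      Delta 8 8 n ≤ C * (n : ℝ) ^ ((-(19/10) : ℝ)) := by
  refine ⟨128 * 31104 * 4096 * 2304 * 200 ^ 6 + Nat.factorial 8 * ((200 : ℝ) ^ 8) ^ (19 / 10 : ℝ),
    by positivity, fun n hn => Real.sSup_le ?_ (by positivity)⟩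
  rintro _ ⟨X, rfl, hX, rfl⟩
  have hn0 : (0 : ℝ) < X.card := by exact_mod_cast (by omega : 0 < X.card)
  rw [add_mul]
  rcases le_total (200 ^ 8) X.card with h | h
  · exact (minSimplexVol_le_mul_rpow X hX h).trans (le_add_of_nonneg_right (by positivity))
  · refine le_trans ?_ (le_add_of_nonneg_left (by positivity))
    refine (minSimplexVol_le_factorial X hX hn).trans ?_
    rw [mul_assoc]
    refine le_mul_of_one_le_right (by positivity) ?_
    rw [Real.rpow_neg hn0.le, ← div_eq_mul_inv, one_le_div (by positivity)]
    gcongr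
    exact_mod_cast h
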